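/- arXiv:2511.02114 — 10 statements merged into one kernel-verified Lean document; each statement's English description precedes it below -/
import Mathlib

section
/- Vanishing of the value function along the closed loop: Let X₁ ⊆ ℝⁿ be compact with 0 ∈ X₁, let U ⊆ ℝᵐ be compact, let f : ℝⁿ × ℝᵐ → ℝⁿ, and let l : ℝⁿ × ℝᵐ → ℝ be continuous with l(0,0) = 0 and l(x,u) > 0 for every (x,u) ≠ (0,0). Let μ : ℝⁿ → ℝᵐ satisfy μ(x) ∈ U and g(x) := f(x, μ(x)) ∈ X₁ for every x ∈ X₁. Let V : ℝⁿ → ℝ satisfy V(x) ≥ 0 for all x ∈ X₁, V(0) = 0, V continuous at 0, and suppose there is α ∈ (0,1] such that V(x) ≥ V(g(x)) + α·l(x, μ(x)) for all x ∈ X₁. Then for every x₀ ∈ X₁ the closed-loop sequence x_M = g^M(x₀) satisfies x_M → 0 and V(x_M) → 0 as M → ∞. -/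
open Filter

/-- A net in a compact set, along which a continuous function vanishing on that set at most
at `a` tends to zero, converges to `a`. -/
theorem IsCompact.tendsto_nhds_of_tendsto_zero {E ι : Type*} [TopologicalSpace E]
    {F : Filter ι} {K : Set E} (hK : IsCompact K) {h : E → ℝ} (hh : Continuous h) {a : E}
    (hzero : ∀ y ∈ K, h y = 0 → y = a) {p : ι → E} (hpK : ∀ᶠ i in F, p i ∈ K)
    (hp : Tendsto (fun i => h (p i)) F (nhds 0)) : Tendsto p F (nhds a) := by
  refine hK.tendsto_nhds_of_unique_mapClusterPt hpK fun y hy hcl => hzero y hy ?_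
  have hcl' : MapClusterPt (h y) F (h ∘ p) := hcl.continuousAt_comp hh.continuousAt
  have : (nhds (h y) ⊓ nhds 0).NeBot := (ClusterPt.mono hcl' hp : ClusterPt (h y) (nhds 0))
  exact eq_of_nhds_neBot this

/-- If a nonnegative real sequence decreases by at least `α * c k` at each step, where `α > 0`
and `c` is nonnegative, then `c` tends to zero. -/
theorem tendsto_zero_of_add_mul_le {v c : ℕ → ℝ} {α : ℝ} (hα : 0 < α) (hv : ∀ k, 0 ≤ v k)
    (hc : ∀ k, 0 ≤ c k) (h : ∀ k, v (k + 1) + α * c k ≤ v k) :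
    Tendsto c atTop (nhds 0) := by
  have hanti : Antitone v :=
    antitone_nat_of_succ_le fun k => by linarith [h k, mul_nonneg hα.le (hc k)]
  have hlim := tendsto_atTop_ciInf hanti ⟨0, Set.forall_mem_range.2 hv⟩
  have hdiff : Tendsto (fun k => (v k - v (k + 1)) / α) atTop (nhds 0) := by
    simpa using (hlim.sub (hlim.comp (tendsto_add_atTop_nat 1))).div_const α
  refine squeeze_zero hc (fun k => ?_) hdiff
  rw [le_div_iff₀ hα]
  linarith [h k]

/-- **Vanishing of the value function along the closed loop.**
Under joint positive definiteness and continuity of the stage cost, compactness of the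
constraint sets, forward invariance of `X₁` under the closed-loop map
`g(x) = f(x, μ(x))`, nonnegativity of `V` on `X₁`, `V(0) = 0`, continuity of `V` at `0`,
and the relaxed dynamic programming inequality `V(x) ≥ V(g(x)) + α·l(x, μ(x))` with
`α ∈ (0,1]`, the closed-loop sequence `x_M = g^M(x₀)` satisfies `x_M → 0` and
`V(x_M) → 0`. -/
theorem value_function_vanishes_along_closed_loop {n m : ℕ}
    (X₁ : Set (Fin n → ℝ)) (U : Set (Fin m → ℝ))
    (f : (Fin n → ℝ) → (Fin m → ℝ) → (Fin n → ℝ))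
    (l : (Fin n → ℝ) → (Fin m → ℝ) → ℝ)
    (μ : (Fin n → ℝ) → (Fin m → ℝ))
    (V : (Fin n → ℝ) → ℝ) (α : ℝ)
    (hX₁compact : IsCompact X₁) (hX₁zero : (0 : Fin n → ℝ) ∈ X₁)
    (hUcompact : IsCompact U)
    (hlcont : Continuous fun p : (Fin n → ℝ) × (Fin m → ℝ) => l p.1 p.2)
    (hl0 : l 0 0 = 0)
    (hlpos : ∀ x u, (x, u) ≠ ((0 : Fin n → ℝ), (0 : Fin m → ℝ)) → 0 < l x u)
    (hμU : ∀ x ∈ X₁, μ x ∈ U)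
    (hinv : ∀ x ∈ X₁, f x (μ x) ∈ X₁)
    (hVnonneg : ∀ x ∈ X₁, 0 ≤ V x)
    (hV0 : V 0 = 0)
    (hVcont : ContinuousAt V 0)
    (hα : α ∈ Set.Ioc (0 : ℝ) 1)
    (hRDP : ∀ x ∈ X₁, V (f x (μ x)) + α * l x (μ x) ≤ V x)
    (x₀ : Fin n → ℝ) (hx₀ : x₀ ∈ X₁) :
    Tendsto (fun M : ℕ => (fun x => f x (μ x))^[M] x₀) atTop (nhds 0) ∧
    Tendsto (fun M : ℕ => V ((fun x => f x (μ x))^[M] x₀)) atTop (nhds 0) := by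
  set x : ℕ → Fin n → ℝ := fun M => (fun x => f x (μ x))^[M] x₀ with hx
  have hsucc : ∀ M, x (M + 1) = f (x M) (μ (x M)) := fun M =>
    Function.iterate_succ_apply' (fun x => f x (μ x)) M x₀
  have hmem : ∀ M, x M ∈ X₁ := by
    intro M
    induction M with
    | zero => exact hx₀
    | succ M ih => rw [hsucc]; exact hinv _ ih
  have hlnonneg : ∀ y u, 0 ≤ l y u := by
    intro y u
    by_cases h : (y, u) = ((0 : Fin n → ℝ), (0 : Fin m → ℝ))
    · obtain ⟨rfl, rfl⟩ := Prod.mk.inj h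
      exact hl0.ge
    · exact (hlpos y u h).le
  have hcost : Tendsto (fun M => l (x M) (μ (x M))) atTop (nhds 0) :=
    tendsto_zero_of_add_mul_le (v := fun M => V (x M)) hα.1 (fun M => hVnonneg _ (hmem M))
      (fun M => hlnonneg _ _) fun M => by
        simpa only [hsucc] using hRDP _ (hmem M)
  have hpair : Tendsto (fun M => (x M, μ (x M))) atTop (nhds (0, 0)) :=
    (hX₁compact.prod hUcompact).tendsto_nhds_of_tendsto_zero hlcont
      (fun y _ hy => by_contra fun hne => (hlpos y.1 y.2 hne).ne' hy)
      (Eventually.of_forall fun M => ⟨hmem M, hμU _ (hmem M)⟩) hcost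
  have hx0 : Tendsto x atTop (nhds 0) := hpair.fst_nhds
  exact ⟨hx0, hV0 ▸ hVcont.tendsto.comp hx0⟩
end

section
/- Relaxed dynamic programming lower bound: Let X ⊆ ℝⁿ, let g : ℝⁿ → ℝⁿ satisfy g(x) ∈ X for every x ∈ X, let ℓ : ℝⁿ → ℝ satisfy ℓ(x) ≥ 0 for every x ∈ X, let V : ℝⁿ → ℝ satisfy V(x) ≥ 0 for every x ∈ X, and let α ∈ [0,1] and ω ∈ [0,1). Assume (i) (1−ω)·ℓ(x) ≥ V(x) − V(g(x)) for all x ∈ X, and (ii) for every x ∈ X the series J(x) := Σ_{k=0}^{∞} ℓ(g^k(x)) converges and V(g^M(x)) → 0 as M → ∞. Then J(x) ≥ V(x)/(1−ω), and hence α·J(x) ≥ (α/(1−ω))·V(x), for every x ∈ X. If in addition V(x) ≥ V(g(x)) + α·ℓ(x) for all x ∈ X, then the two-sided bound V(x) ≥ α·J(x) ≥ (α/(1−ω))·V(x) holds for every x ∈ X. -/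
open Filter

/-- If the decrements of a sequence tending to `0` are bounded by `c` times the terms of a
summable series, then its first term is bounded by `c` times the sum of the series. -/
theorem le_mul_tsum_of_sub_succ_le {a v : ℕ → ℝ} {c : ℝ} (ha : Summable a)
    (hv : Tendsto v atTop (nhds 0)) (h : ∀ k, v k - v (k + 1) ≤ c * a k) :
    v 0 ≤ c * ∑' k, a k := by
  have hleft : Tendsto (fun M => v 0 - v M) atTop (nhds (v 0)) := by
    simpa using tendsto_const_nhds.sub hv
  refine le_of_tendsto_of_tendsto' hleft (ha.hasSum.tendsto_sum_nat.const_mul c) fun M => ?_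
  rw [← Finset.sum_range_sub' v M, Finset.mul_sum]
  exact Finset.sum_le_sum fun k _ => h k

/-- If the decrements of a sequence tending to `0` dominate `c` times the terms of a
summable series, then its first term dominates `c` times the sum of the series. -/
theorem mul_tsum_le_of_le_sub_succ {a v : ℕ → ℝ} {c : ℝ} (ha : Summable a)
    (hv : Tendsto v atTop (nhds 0)) (h : ∀ k, c * a k ≤ v k - v (k + 1)) :
    c * ∑' k, a k ≤ v 0 := by
  have := le_mul_tsum_of_sub_succ_le (v := fun k => -v k) (c := -c) ha (by simpa using hv.neg)
    fun k => by linarith [h k]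
  linarith

/-- **Relaxed dynamic programming lower bound.**
If `(1−ω)·ℓ(x) ≥ V(x) − V(g(x))` on a forward-invariant set `X`, the closed-loop series
`J(x) = Σ_{k=0}^{∞} ℓ(g^k(x))` converges and `V(g^M(x)) → 0`, then
`J(x) ≥ V(x)/(1−ω)` and `α·J(x) ≥ (α/(1−ω))·V(x)` for every `x ∈ X`.  If in addition
the RDP upper inequality `V(x) ≥ V(g(x)) + α·ℓ(x)` holds on `X`, then the two-sided
bound `V(x) ≥ α·J(x) ≥ (α/(1−ω))·V(x)` holds on `X`. -/
theorem rdp_lower_bound {n : ℕ} (X : Set (Fin n → ℝ))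
    (g : (Fin n → ℝ) → (Fin n → ℝ))
    (ℓ V : (Fin n → ℝ) → ℝ) (α ω : ℝ)
    (hg : ∀ x ∈ X, g x ∈ X)
    (hℓ : ∀ x ∈ X, 0 ≤ ℓ x)
    (hV : ∀ x ∈ X, 0 ≤ V x)
    (hα : α ∈ Set.Icc (0 : ℝ) 1)
    (hω : ω ∈ Set.Ico (0 : ℝ) 1)
    (hRDPlow : ∀ x ∈ X, V x - V (g x) ≤ (1 - ω) * ℓ x)
    (hconv : ∀ x ∈ X, Summable (fun k : ℕ => ℓ (g^[k] x)) ∧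
      Tendsto (fun M : ℕ => V (g^[M] x)) atTop (nhds 0)) :
    (∀ x ∈ X,
      V x / (1 - ω) ≤ ∑' k : ℕ, ℓ (g^[k] x) ∧
      α / (1 - ω) * V x ≤ α * ∑' k : ℕ, ℓ (g^[k] x)) ∧
    ((∀ x ∈ X, V (g x) + α * ℓ x ≤ V x) →
      ∀ x ∈ X,
        α * ∑' k : ℕ, ℓ (g^[k] x) ≤ V x ∧
        α / (1 - ω) * V x ≤ α * ∑' k : ℕ, ℓ (g^[k] x)) := by
  have hiter : ∀ x ∈ X, ∀ k : ℕ, g^[k] x ∈ X := fun x hx k =>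
    (show Set.MapsTo g X X from hg).iterate k hx
  have hlow : ∀ x ∈ X, V x / (1 - ω) ≤ ∑' k : ℕ, ℓ (g^[k] x) ∧
      α / (1 - ω) * V x ≤ α * ∑' k : ℕ, ℓ (g^[k] x) := by
    intro x hx
    have hdiv : V x / (1 - ω) ≤ ∑' k : ℕ, ℓ (g^[k] x) := by
      rw [div_le_iff₀' (sub_pos.2 hω.2)]
      refine le_mul_tsum_of_sub_succ_le (v := fun k => V (g^[k] x))
        (hconv x hx).1 (hconv x hx).2 fun k => ?_
      rw [Function.iterate_succ_apply']
      exact hRDPlow _ (hiter x hx k)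
    refine ⟨hdiv, ?_⟩
    rw [div_mul_eq_mul_div, mul_div_assoc]
    exact mul_le_mul_of_nonneg_left hdiv hα.1
  refine ⟨hlow, fun hup x hx => ⟨?_, (hlow x hx).2⟩⟩
  refine mul_tsum_le_of_le_sub_succ (v := fun k => V (g^[k] x))
    (hconv x hx).1 (hconv x hx).2 fun k => ?_
  rw [Function.iterate_succ_apply']
  linarith [hup _ (hiter x hx k)]
end

section
/- Lower bound on the one-step decrease of the HC-MPC value function: Fix integers N ≥ 3 and 2 ≤ Ñ ≤ N−1, and let x ∈ X₁. Let u* be an HC-admissible sequence attaining V_N^Ñ(x) with trajectory x*(·); set x⁺ = f(x, u*(0)) (so x⁺ = x*(1)) and x_s = x*(N−Ñ+1). If the minima V_N^Ñ(x⁺), V_Ñ^Ñ(x_s) and V_{Ñ−1}(x_s) are all attained, then V_N^Ñ(x) − V_N^Ñ(x⁺) ≥ l(x, u*(0)) − ( V_Ñ^Ñ(x_s) − V_{Ñ−1}(x_s) ). -/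
/-!
Setting for heterogeneously constrained MPC (HC-MPC) and uniformly constrained
MPC (UC-MPC).  `f : ℝⁿ × ℝᵐ → ℝⁿ` is the discrete-time system map, `U ⊆ ℝᵐ`
the input-constraint set, `X₁ ⊆ X₂ ⊆ ℝⁿ` the state-constraint sets, and
`l : ℝⁿ × ℝᵐ → ℝ` the (nonnegative) stage cost.
-/

/-- The open-loop trajectory generated from initial state `x` by the input
sequence `u`: `x(0) = x`, `x(k+1) = f(x(k), u(k))`. -/
def Traj {n m : ℕ} (f : (Fin n → ℝ) → (Fin m → ℝ) → (Fin n → ℝ))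
    (x : Fin n → ℝ) (u : ℕ → (Fin m → ℝ)) : ℕ → (Fin n → ℝ)
  | 0 => x
  | k + 1 => f (Traj f x u k) (u k)

/-- The `N`-stage open-loop cost `Σ_{k=0}^{N-1} l(x(k), u(k))`. -/
def Cost {n m : ℕ} (f : (Fin n → ℝ) → (Fin m → ℝ) → (Fin n → ℝ))
    (l : (Fin n → ℝ) → (Fin m → ℝ) → ℝ)
    (x : Fin n → ℝ) (u : ℕ → (Fin m → ℝ)) (N : ℕ) : ℝ :=
  ∑ k ∈ Finset.range N, l (Traj f x u k) (u k)

/-- HC-admissibility at `x` with prediction horizon `N` and constraint horizon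
`Nt` (written `Ñ` in the paper): inputs lie in `U`, the predicted states
`x(n+1)` lie in `X₁` for `n = 0,…,N−Ñ` and in `X₂` for `n = N−Ñ+1,…,N−1`. -/
def HCAdm {n m : ℕ} (f : (Fin n → ℝ) → (Fin m → ℝ) → (Fin n → ℝ))
    (U : Set (Fin m → ℝ)) (X₁ X₂ : Set (Fin n → ℝ))
    (N Nt : ℕ) (x : Fin n → ℝ) (u : ℕ → (Fin m → ℝ)) : Prop :=
  (∀ k, k < N → u k ∈ U) ∧
  (∀ k, k ≤ N - Nt → Traj f x u (k + 1) ∈ X₁) ∧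
  (∀ k, N - Nt + 1 ≤ k → k ≤ N - 1 → Traj f x u (k + 1) ∈ X₂)

/-- UC-admissibility at `x` with horizon `N`: inputs lie in `U` and all
predicted states `x(n+1)`, `n = 0,…,N−1`, lie in `X₂`. -/
def UCAdm {n m : ℕ} (f : (Fin n → ℝ) → (Fin m → ℝ) → (Fin n → ℝ))
    (U : Set (Fin m → ℝ)) (X₂ : Set (Fin n → ℝ))
    (N : ℕ) (x : Fin n → ℝ) (u : ℕ → (Fin m → ℝ)) : Prop :=
  (∀ k, k < N → u k ∈ U) ∧
  (∀ k, k < N → Traj f x u (k + 1) ∈ X₂)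

/-- `V` is the attained minimum `V_N^Ñ(x)` of the HC-MPC problem: some
HC-admissible sequence realizes cost `V`, and `V` is a lower bound on the cost
of every HC-admissible sequence. -/
def IsHCValue {n m : ℕ} (f : (Fin n → ℝ) → (Fin m → ℝ) → (Fin n → ℝ))
    (U : Set (Fin m → ℝ)) (X₁ X₂ : Set (Fin n → ℝ))
    (l : (Fin n → ℝ) → (Fin m → ℝ) → ℝ)
    (N Nt : ℕ) (x : Fin n → ℝ) (V : ℝ) : Prop :=
  (∃ u, HCAdm f U X₁ X₂ N Nt x u ∧ Cost f l x u N = V) ∧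
  (∀ u, HCAdm f U X₁ X₂ N Nt x u → V ≤ Cost f l x u N)

/-- `V` is the attained minimum `V_N(x)` of the UC-MPC problem. -/
def IsUCValue {n m : ℕ} (f : (Fin n → ℝ) → (Fin m → ℝ) → (Fin n → ℝ))
    (U : Set (Fin m → ℝ)) (X₂ : Set (Fin n → ℝ))
    (l : (Fin n → ℝ) → (Fin m → ℝ) → ℝ)
    (N : ℕ) (x : Fin n → ℝ) (V : ℝ) : Prop :=
  (∃ u, UCAdm f U X₂ N x u ∧ Cost f l x u N = V) ∧
  (∀ u, UCAdm f U X₂ N x u → V ≤ Cost f l x u N)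

section Concatenation

variable {n m : ℕ} (f : (Fin n → ℝ) → (Fin m → ℝ) → (Fin n → ℝ))
  (l : (Fin n → ℝ) → (Fin m → ℝ) → ℝ) (x : Fin n → ℝ)

theorem traj_add (u : ℕ → (Fin m → ℝ)) (p j : ℕ) :
    Traj f x u (p + j) = Traj f (Traj f x u p) (fun i => u (p + i)) j := by
  induction j with
  | zero => rfl
  | succ j ih => rw [← add_assoc, Traj, ih, Traj]

theorem traj_congr {u v : ℕ → (Fin m → ℝ)} {k : ℕ} (h : ∀ i < k, u i = v i) :
    Traj f x u k = Traj f x v k := by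
  induction k with
  | zero => rfl
  | succ k ih =>
    simp only [Traj, ih fun i hi => h i (hi.trans k.lt_succ_self), h k k.lt_succ_self]

theorem cost_add (u : ℕ → (Fin m → ℝ)) (p q : ℕ) :
    Cost f l x u (p + q) =
      Cost f l x u p + Cost f l (Traj f x u p) (fun i => u (p + i)) q := by
  simp only [Cost, Finset.sum_range_add, traj_add]

theorem cost_congr {u v : ℕ → (Fin m → ℝ)} {k : ℕ} (h : ∀ i < k, u i = v i) :
    Cost f l x u k = Cost f l x v k := by
  refine Finset.sum_congr rfl fun i hi => ?_
  have hi := Finset.mem_range.mp hi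
  rw [traj_congr f x fun j hj => h j (hj.trans hi), h i hi]

/-- The input sequence that applies `u` for `p` steps and then switches to `v`. -/
def concatInput (u v : ℕ → (Fin m → ℝ)) (p : ℕ) : ℕ → (Fin m → ℝ) :=
  fun k => if k < p then u k else v (k - p)

theorem concatInput_of_lt (u v : ℕ → (Fin m → ℝ)) {p k : ℕ} (h : k < p) :
    concatInput u v p k = u k :=
  if_pos h

theorem concatInput_add (u v : ℕ → (Fin m → ℝ)) (p k : ℕ) :
    concatInput u v p (p + k) = v k := by
  simp [concatInput]

theorem traj_concatInput_of_le (u v : ℕ → (Fin m → ℝ)) {p k : ℕ} (h : k ≤ p) :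
    Traj f x (concatInput u v p) k = Traj f x u k :=
  traj_congr f x fun _ hi => concatInput_of_lt u v (hi.trans_le h)

theorem traj_concatInput_add (u v : ℕ → (Fin m → ℝ)) (p j : ℕ) :
    Traj f x (concatInput u v p) (p + j) = Traj f (Traj f x u p) v j := by
  simp only [traj_add, traj_concatInput_of_le f x u v le_rfl, concatInput_add]

theorem cost_concatInput (u v : ℕ → (Fin m → ℝ)) (p q : ℕ) :
    Cost f l x (concatInput u v p) (p + q) =
      Cost f l x u p + Cost f l (Traj f x u p) v q := by
  simp only [cost_add, traj_concatInput_of_le f x u v le_rfl, concatInput_add,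
    cost_congr f l x fun _ hi => concatInput_of_lt u v hi]

/-- Following `u` for `p` steps inside `X₁` and then an admissible sequence whose
prediction and constraint horizons coincide gives an admissible sequence. -/
theorem HCAdm.concatInput {U : Set (Fin m → ℝ)} {X₁ X₂ : Set (Fin n → ℝ)}
    {u v : ℕ → (Fin m → ℝ)} {p q : ℕ} (hu : ∀ k < p, u k ∈ U)
    (hX₁ : ∀ k < p, Traj f x u (k + 1) ∈ X₁)
    (hv : HCAdm f U X₁ X₂ q q (Traj f x u p) v) :
    HCAdm f U X₁ X₂ (p + q) q x (concatInput u v p) := by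
  obtain ⟨hvU, hv₁, hv₂⟩ := hv
  refine ⟨fun k hk => ?_, fun k hk => ?_, fun k hk hk' => ?_⟩
  · rcases lt_or_ge k p with h | h
    · exact concatInput_of_lt u v h ▸ hu k h
    · obtain ⟨j, rfl⟩ := Nat.exists_eq_add_of_le h
      exact concatInput_add u v p j ▸ hvU j (by omega)
  · rcases lt_or_ge k p with h | h
    · exact traj_concatInput_of_le f x u v h ▸ hX₁ k h
    · obtain rfl : k = p := by omega
      exact traj_concatInput_add f x u v k 1 ▸ hv₁ 0 (by omega)
  · obtain ⟨j, rfl⟩ := Nat.exists_eq_add_of_le (show p ≤ k by omega)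
    rw [add_assoc, traj_concatInput_add]
    exact hv₂ j (by omega) (by omega)

/-- The tail of an HC-admissible sequence, starting at the last state that is
required to lie in `X₁`, is UC-admissible. -/
theorem HCAdm.tail {U : Set (Fin m → ℝ)} {X₁ X₂ : Set (Fin n → ℝ)}
    {u : ℕ → (Fin m → ℝ)} {N Nt : ℕ} (hNt : Nt ≤ N) (h : HCAdm f U X₁ X₂ N Nt x u) :
    UCAdm f U X₂ (Nt - 1) (Traj f x u (N - Nt + 1)) (fun i => u (N - Nt + 1 + i)) := by
  obtain ⟨hU, -, h₂⟩ := h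
  refine ⟨fun k hk => hU _ (by omega), fun k hk => ?_⟩
  rw [← traj_add]
  exact h₂ (N - Nt + 1 + k) (by omega) (by omega)

end Concatenation

/-- **Lower bound on the one-step decrease of the HC-MPC value function (Lemma 4).**
With `x⁺ = f(x, u*(0))` and `x_s = x*(N−Ñ+1)` along an optimal sequence for
`V_N^Ñ(x)`, one has
`V_N^Ñ(x) − V_N^Ñ(x⁺) ≥ l(x, u*(0)) − (V_Ñ^Ñ(x_s) − V_{Ñ−1}(x_s))`. -/
theorem one_step_decrease_lower_bound {n m : ℕ}
    (f : (Fin n → ℝ) → (Fin m → ℝ) → (Fin n → ℝ))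
    (U : Set (Fin m → ℝ)) (X₁ X₂ : Set (Fin n → ℝ))
    (l : (Fin n → ℝ) → (Fin m → ℝ) → ℝ)
    (hl : ∀ x u, 0 ≤ l x u) (hX : X₁ ⊆ X₂)
    (N Nt : ℕ) (hN : 3 ≤ N) (hNt₁ : 2 ≤ Nt) (hNt₂ : Nt ≤ N - 1)
    (x : Fin n → ℝ) (hx : x ∈ X₁)
    (u : ℕ → (Fin m → ℝ)) (V : ℝ)
    (hadm : HCAdm f U X₁ X₂ N Nt x u)
    (hcost : Cost f l x u N = V)
    (hmin : ∀ u', HCAdm f U X₁ X₂ N Nt x u' → V ≤ Cost f l x u' N)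
    (Vplus A B : ℝ)
    (hVplus : IsHCValue f U X₁ X₂ l N Nt (f x (u 0)) Vplus)
    (hA : IsHCValue f U X₁ X₂ l Nt Nt (Traj f x u (N - Nt + 1)) A)
    (hB : IsUCValue f U X₂ l (Nt - 1) (Traj f x u (N - Nt + 1)) B) :
    l x (u 0) - (A - B) ≤ V - Vplus := by
  obtain ⟨⟨v, hv, rfl⟩, -⟩ := hA
  obtain ⟨p, rfl⟩ : ∃ p, N = p + Nt := ⟨N - Nt, by omega⟩
  have hB_le := hB.2 _ (hadm.tail f x (Nat.le_add_left Nt p))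
  simp only [Nat.add_sub_cancel] at hv hB_le ⊢
  have traj_shift (k : ℕ) :
      Traj f (f x (u 0)) (fun i => u (1 + i)) k = Traj f x u (k + 1) := by
    rw [add_comm k 1, traj_add]
    rfl
  have hVplus_le := hVplus.2 _ <| HCAdm.concatInput f (f x (u 0))
    (u := fun i => u (1 + i)) (v := v) (p := p) (q := Nt)
    (fun k hk => hadm.1 _ (by omega))
    (fun k hk => traj_shift _ ▸ hadm.2.1 (k + 1) (by omega))
    ((traj_shift p).symm ▸ hv)
  rw [cost_concatInput, traj_shift] at hVplus_le
  have cost_tail := cost_add f l x u (p + 1) (Nt - 1)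
  rw [show p + 1 + (Nt - 1) = p + Nt by omega] at cost_tail
  have cost_head : Cost f l x u (p + 1) =
      l x (u 0) + Cost f l (f x (u 0)) (fun i => u (1 + i)) p := by
    rw [add_comm p 1, cost_add]
    simp [Cost, Traj]
  linarith
end

section
/- Closed-loop cost upper bound (Proposition 2): Fix integers N ≥ 2 and 2 ≤ Ñ ≤ N, and let x ∈ X₁. Let u_h* attain V_N^Ñ(x) with trajectory x_h*(·); set λ₀ = l(x, u_h*(0)), λ_{N−Ñ} = l(x_h*(N−Ñ), u_h*(N−Ñ)) and x_s = x_h*(N−Ñ+1). Assume V_{Ñ−1}(x_s) is attained by optimal pairs (x_d'(n), u_d'(n)), n = 0,…,Ñ−2, and that the tail identity Σ_{n=N−Ñ+1}^{N−1} l(x_h*(n), u_h*(n)) = V_{Ñ−1}(x_s) holds. Assume constants C₁ ≥ 1, C₂ > 0 and 0 ≤ σ₂ < σ₁ < 1 such that l(x_h*(n), u_h*(n)) ≤ C₁·σ₁ⁿ·λ₀ for n = 0,…,N−Ñ and l(x_d'(n), u_d'(n)) ≤ C₂·σ₂^{n+1}·λ_{N−Ñ} for n = 0,…,Ñ−2.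 Let α ∈ (0,1] and J ∈ ℝ satisfy α·J ≤ V_N^Ñ(x), and let L ∈ ℝ satisfy λ₀ ≤ L. Then J ≤ C₁·[ (1−σ₁^{N−Ñ+1})/(1−σ₁) + C₂·σ₁^{N−Ñ}·σ₂·(1−σ₂^{Ñ−1})/(1−σ₂) ]·L/α. -/
/-- **Closed-loop cost upper bound (Proposition 2).**
With the decay bounds of the maximum-rate cost-controllability assumption and
the tail identity, any `J` satisfying the RDP bound `α·J ≤ V_N^Ñ(x)` with
`α ∈ (0,1]` obeys
`J ≤ C₁[(1−σ₁^{N−Ñ+1})/(1−σ₁) + C₂σ₁^{N−Ñ}σ₂(1−σ₂^{Ñ−1})/(1−σ₂)]·L/α`. -/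
theorem closed_loop_upper_bound_prop2 {n m : ℕ}
    (f : (Fin n → ℝ) → (Fin m → ℝ) → (Fin n → ℝ))
    (U : Set (Fin m → ℝ)) (X₁ X₂ : Set (Fin n → ℝ))
    (l : (Fin n → ℝ) → (Fin m → ℝ) → ℝ)
    (hl : ∀ x u, 0 ≤ l x u) (hX : X₁ ⊆ X₂)
    (N Nt : ℕ) (hN : 2 ≤ N) (hNt₁ : 2 ≤ Nt) (hNt₂ : Nt ≤ N)
    (x : Fin n → ℝ) (hx : x ∈ X₁)
    -- the optimal sequence attaining `V_N^Ñ(x)`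
    (uh : ℕ → (Fin m → ℝ)) (V : ℝ)
    (hadm : HCAdm f U X₁ X₂ N Nt x uh)
    (hcost : Cost f l x uh N = V)
    (hmin : ∀ u', HCAdm f U X₁ X₂ N Nt x u' → V ≤ Cost f l x u' N)
    (lam0 lamNmNt : ℝ)
    (hlam0 : lam0 = l x (uh 0))
    (hlamNmNt : lamNmNt = l (Traj f x uh (N - Nt)) (uh (N - Nt)))
    -- `V_{Ñ−1}(x_s)` attained by the optimal pairs `(x_d'(k), u_d'(k))`
    (B : ℝ)
    (hB : IsUCValue f U X₂ l (Nt - 1) (Traj f x uh (N - Nt + 1)) B)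
    (ud' : ℕ → (Fin m → ℝ))
    (hadmd : UCAdm f U X₂ (Nt - 1) (Traj f x uh (N - Nt + 1)) ud')
    (hcostd : Cost f l (Traj f x uh (N - Nt + 1)) ud' (Nt - 1) = B)
    -- tail identity
    (htail : ∑ k ∈ Finset.Ico (N - Nt + 1) N, l (Traj f x uh k) (uh k) = B)
    -- decay-rate assumptions
    (C₁ C₂ σ₁ σ₂ : ℝ)
    (hC₁ : 1 ≤ C₁) (hC₂ : 0 < C₂)
    (hσ₂0 : 0 ≤ σ₂) (hσ₂₁ : σ₂ < σ₁) (hσ₁ : σ₁ < 1)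
    (hi : ∀ k, k ≤ N - Nt → l (Traj f x uh k) (uh k) ≤ C₁ * σ₁ ^ k * lam0)
    (hii : ∀ k, k ≤ Nt - 2 →
      l (Traj f (Traj f x uh (N - Nt + 1)) ud' k) (ud' k) ≤
        C₂ * σ₂ ^ (k + 1) * lamNmNt)
    -- the RDP bound and the cost upper bound `L`
    (α J L : ℝ) (hα : α ∈ Set.Ioc (0 : ℝ) 1)
    (hJ : α * J ≤ V) (hL : lam0 ≤ L) :
    J ≤ C₁ * ((1 - σ₁ ^ (N - Nt + 1)) / (1 - σ₁) +
        C₂ * σ₁ ^ (N - Nt) * σ₂ * (1 - σ₂ ^ (Nt - 1)) / (1 - σ₂)) * L / α := by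
  have hσ₁0 : 0 < σ₁ := hσ₂0.trans_lt hσ₂₁
  have hlam0_nonneg : 0 ≤ lam0 := hlam0 ▸ hl _ _
  have geom : ∀ r : ℝ, r < 1 → ∀ k : ℕ,
      ∑ i ∈ Finset.range k, r ^ i = (1 - r ^ k) / (1 - r) := by
    intro r hr k
    rw [eq_div_iff (by linarith), geom_sum_mul_neg]
  have hhead : ∑ k ∈ Finset.range (N - Nt + 1), l (Traj f x uh k) (uh k) ≤
      C₁ * lam0 * ((1 - σ₁ ^ (N - Nt + 1)) / (1 - σ₁)) := by
    rw [← geom σ₁ hσ₁, Finset.mul_sum]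
    refine Finset.sum_le_sum fun k hk => (hi k ?_).trans_eq (by ring)
    have := Finset.mem_range.mp hk
    omega
  have htail_le : B ≤ C₂ * σ₂ * lamNmNt * ((1 - σ₂ ^ (Nt - 1)) / (1 - σ₂)) := by
    rw [← hcostd, Cost, ← geom σ₂ (hσ₂₁.trans hσ₁), Finset.mul_sum]
    refine Finset.sum_le_sum fun k hk => (hii k ?_).trans_eq (by ring)
    have := Finset.mem_range.mp hk
    omega
  have hsplit : V = ∑ k ∈ Finset.range (N - Nt + 1), l (Traj f x uh k) (uh k) + B := by
    rw [← hcost, Cost, ← htail, Finset.sum_range_add_sum_Ico _ (by omega)]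
  have hlam_le : lamNmNt ≤ C₁ * σ₁ ^ (N - Nt) * lam0 := hlamNmNt ▸ hi _ le_rfl
  have hS₁ : 0 ≤ (1 - σ₁ ^ (N - Nt + 1)) / (1 - σ₁) := by
    rw [← geom σ₁ hσ₁]
    positivity
  have hS₂ : 0 ≤ (1 - σ₂ ^ (Nt - 1)) / (1 - σ₂) := by
    rw [← geom σ₂ (hσ₂₁.trans hσ₁)]
    positivity
  rw [le_div_iff₀ hα.1, mul_div_assoc]
  generalize (1 - σ₁ ^ (N - Nt + 1)) / (1 - σ₁) = S₁ at *
  generalize (1 - σ₂ ^ (Nt - 1)) / (1 - σ₂) = S₂ at *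
  have hC₁0 : 0 < C₁ := by linarith
  calc J * α ≤ V := by linarith
    _ ≤ C₁ * lam0 * S₁ + C₂ * σ₂ * lamNmNt * S₂ := by linarith
    _ ≤ C₁ * lam0 * S₁ + C₂ * σ₂ * (C₁ * σ₁ ^ (N - Nt) * lam0) * S₂ := by gcongr
    _ = C₁ * (S₁ + C₂ * σ₁ ^ (N - Nt) * σ₂ * S₂) * lam0 := by ring
    _ ≤ C₁ * (S₁ + C₂ * σ₁ ^ (N - Nt) * σ₂ * S₂) * L := by gcongr
end

section
/- Stabilizing horizon condition (Proposition 3): Let C₁ ≥ 1, C₂ > 0, δ ≥ 0 and 0 ≤ σ₂ < σ₁ < 1 be real numbers, and let N, Ñ be integers with N ≥ 3 and 2 ≤ Ñ ≤ N−1. If (N−Ñ+1)·log(1/σ₁) ≥ log( C₁·C₂·( δ/(1−σ₂) + 1 ) ), then 1 − C₁·C₂·σ₁^{N−Ñ}·σ₂·( δ·(1−σ₂^Ñ)/(1−σ₂) + σ₂^{Ñ−1} ) ≥ 0. -/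
/-- **Stabilizing horizon condition (Proposition 3).**
If the prediction horizon `N` and constraint horizon `Ñ` satisfy
`(N−Ñ+1)·log(1/σ₁) ≥ log(C₁C₂(δ/(1−σ₂)+1))`, then the explicit suboptimality
constant `α = 1 − C₁C₂σ₁^{N−Ñ}σ₂(δ(1−σ₂^Ñ)/(1−σ₂) + σ₂^{Ñ−1})` is
nonnegative. -/
theorem stabilizing_horizon_condition
    (C₁ C₂ δ σ₁ σ₂ : ℝ)
    (hC₁ : 1 ≤ C₁) (hC₂ : 0 < C₂) (hδ : 0 ≤ δ)
    (hσ₂0 : 0 ≤ σ₂) (hσ₂₁ : σ₂ < σ₁) (hσ₁ : σ₁ < 1)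
    (N Nt : ℕ) (hN : 3 ≤ N) (hNt₁ : 2 ≤ Nt) (hNt₂ : Nt ≤ N - 1)
    (hhor : Real.log (C₁ * C₂ * (δ / (1 - σ₂) + 1)) ≤
      ((N : ℝ) - (Nt : ℝ) + 1) * Real.log (1 / σ₁)) :
    0 ≤ 1 - C₁ * C₂ * σ₁ ^ (N - Nt) * σ₂ *
      (δ * (1 - σ₂ ^ Nt) / (1 - σ₂) + σ₂ ^ (Nt - 1)) := by
  have h1 : 0 < σ₁ := hσ₂0.trans_lt hσ₂₁
  have h2 : 0 < 1 - σ₂ := by linarith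
  have hC : 0 < C₁ * C₂ := by positivity
  obtain ⟨m, rfl⟩ : ∃ m, N = Nt + m := ⟨N - Nt, by omega⟩
  have hK : 0 < C₁ * C₂ * (δ / (1 - σ₂) + 1) := by positivity
  have hbound : C₁ * C₂ * (δ / (1 - σ₂) + 1) * σ₁ ^ (m + 1) ≤ 1 := by
    rw [← Real.log_nonpos_iff (by positivity), Real.log_mul hK.ne' (by positivity), Real.log_pow]
    rw [one_div, Real.log_inv] at hhor
    push_cast at hhor ⊢
    linarith
  have hsum : δ * (1 - σ₂ ^ Nt) / (1 - σ₂) + σ₂ ^ (Nt - 1) ≤ δ / (1 - σ₂) + 1 := by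
    have hp : 0 ≤ σ₂ ^ Nt := by positivity
    gcongr
    · exact mul_le_of_le_one_right hδ (by linarith)
    · exact pow_le_one₀ hσ₂0 (by linarith)
  have hsum_nonneg : 0 ≤ δ * (1 - σ₂ ^ Nt) / (1 - σ₂) + σ₂ ^ (Nt - 1) := by
    have hp : 0 ≤ 1 - σ₂ ^ Nt := sub_nonneg.2 (pow_le_one₀ hσ₂0 (by linarith))
    positivity
  rw [Nat.add_sub_cancel_left, sub_nonneg]
  calc C₁ * C₂ * σ₁ ^ m * σ₂ * (δ * (1 - σ₂ ^ Nt) / (1 - σ₂) + σ₂ ^ (Nt - 1))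
      ≤ C₁ * C₂ * σ₁ ^ m * σ₁ * (δ / (1 - σ₂) + 1) := by gcongr
    _ = C₁ * C₂ * (δ / (1 - σ₂) + 1) * σ₁ ^ (m + 1) := by ring
    _ ≤ 1 := hbound
end

section
/- Explicit bound yielding the constant δ (Proposition 4): Fix integers N ≥ 3 and 2 ≤ Ñ ≤ N−1. Let x_s ∈ X₁ with x_s ≠ 0, and suppose V_Ñ^Ñ(x_s) is attained and V_Ñ(x_s) is attained by optimal pairs (x_d'(n), u_d'(n)), n = 0,…,Ñ−1, with x_d'(0) = x_s. Assume: (a) there exists ũ₀ ∈ U with f(x_s, ũ₀) = x_s; (b) there exists ũ₁ ∈ U with f(x_s, ũ₁) = x_d'(2); (c) the extrema M = max_{u∈U} l(x_s,u), m₁ = min_{u∈U} l(x_s,u) and m₂ = min_{u₁,u₂∈U} l(f(x_s,u₁), u₂) are attained with m₁ > 0 and m₂ > 0, and, setting ρ₁ = M/m₁ − 1 and ρ₂ = M/m₂ − 1, one has ρ₂ ≥ 0; (d) there are constants C₁ ≥ 1, C₂ > 0, 0 ≤ σ₂ < σ₁ < 1 and a real λ₀ ≥ 0 with l(x_d'(0),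 u_d'(0)) ≤ C₁·C₂·σ₁^{N−Ñ}·σ₂·λ₀ and l(x_d'(1), u_d'(1)) ≤ C₁·C₂·σ₁^{N−Ñ}·σ₂²·λ₀. Then V_Ñ^Ñ(x_s) − V_Ñ(x_s) ≤ C₁·C₂·σ₁^{N−Ñ}·σ₂·( ρ₁ + σ₂·ρ₂ )·λ₀. -/
/-- If `m` is a positive lower bound of `a` and `0 ≤ M / m - 1`, then the gap `M - a` is at most
`(M / m - 1) * b` for every `b ≥ a`. -/
lemma sub_le_div_sub_one_mul {M m a b : ℝ} (hm : 0 < m) (hma : m ≤ a) (hab : a ≤ b)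
    (hM : 0 ≤ M / m - 1) : M - a ≤ (M / m - 1) * b := by
  have h : M / m * m = M := div_mul_cancel₀ M hm.ne'
  have h₁ : M / m * m ≤ M / m * a := mul_le_mul_of_nonneg_left hma (by linarith)
  have h₂ : (M / m - 1) * a ≤ (M / m - 1) * b := mul_le_mul_of_nonneg_left hab hM
  linarith

/-- Trajectories which agree at time `k₀` and use the same inputs from then on coincide from
time `k₀` on. -/
lemma Traj_eq_of_le {n m : ℕ} {f : (Fin n → ℝ) → (Fin m → ℝ) → (Fin n → ℝ)}
    {x y : Fin n → ℝ} {u v : ℕ → (Fin m → ℝ)} {k₀ : ℕ} (h : Traj f x u k₀ = Traj f y v k₀)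
    (huv : ∀ k, k₀ ≤ k → u k = v k) {k : ℕ} (hk : k₀ ≤ k) : Traj f x u k = Traj f y v k := by
  induction k, hk using Nat.le_induction with
  | base => exact h
  | succ k hk ih => simp only [Traj, ih, huv k hk]

/-- **Explicit bound yielding the constant `δ` (Proposition 4).**
Under the input-capacity assumptions (a)–(b), the extremal-cost ratios
`ρ₁ = M/m₁ − 1`, `ρ₂ = M/m₂ − 1`, and the decay bounds (d), the constraint gap
satisfies `V_Ñ^Ñ(x_s) − V_Ñ(x_s) ≤ C₁C₂σ₁^{N−Ñ}σ₂(ρ₁ + σ₂ρ₂)λ₀`. -/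
theorem explicit_delta_bound_prop4 {n m : ℕ}
    (f : (Fin n → ℝ) → (Fin m → ℝ) → (Fin n → ℝ))
    (U : Set (Fin m → ℝ)) (X₁ X₂ : Set (Fin n → ℝ))
    (l : (Fin n → ℝ) → (Fin m → ℝ) → ℝ)
    (hl : ∀ x u, 0 ≤ l x u) (hX : X₁ ⊆ X₂)
    (N Nt : ℕ) (hN : 3 ≤ N) (hNt₁ : 2 ≤ Nt) (hNt₂ : Nt ≤ N - 1)
    (xs : Fin n → ℝ) (hxs : xs ∈ X₁) (hxs0 : xs ≠ 0)
    -- `V_Ñ^Ñ(x_s)` attained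
    (A : ℝ) (hA : IsHCValue f U X₁ X₂ l Nt Nt xs A)
    -- `V_Ñ(x_s)` attained by the optimal pairs `(x_d'(k), u_d'(k))`
    (D : ℝ) (hD : IsUCValue f U X₂ l Nt xs D)
    (ud' : ℕ → (Fin m → ℝ))
    (hadmd : UCAdm f U X₂ Nt xs ud')
    (hcostd : Cost f l xs ud' Nt = D)
    -- (a) an input keeping the system at `x_s`
    (u₀ : Fin m → ℝ) (hu₀U : u₀ ∈ U) (hu₀ : f xs u₀ = xs)
    -- (b) an input driving `x_s` to `x_d'(2)` in one step
    (u₁ : Fin m → ℝ) (hu₁U : u₁ ∈ U) (hu₁ : f xs u₁ = Traj f xs ud' 2)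
    -- (c) attained extremal costs
    (M m₁ m₂ : ℝ)
    (hMmem : ∃ u ∈ U, l xs u = M) (hMub : ∀ u ∈ U, l xs u ≤ M)
    (hm₁mem : ∃ u ∈ U, l xs u = m₁) (hm₁lb : ∀ u ∈ U, m₁ ≤ l xs u)
    (hm₂mem : ∃ u₁' ∈ U, ∃ u₂' ∈ U, l (f xs u₁') u₂' = m₂)
    (hm₂lb : ∀ u₁' ∈ U, ∀ u₂' ∈ U, m₂ ≤ l (f xs u₁') u₂')
    (hm₁pos : 0 < m₁) (hm₂pos : 0 < m₂)
    (hρ₂ : 0 ≤ M / m₂ - 1)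
    -- (d) decay-rate bounds
    (C₁ C₂ σ₁ σ₂ lam0 : ℝ)
    (hC₁ : 1 ≤ C₁) (hC₂ : 0 < C₂)
    (hσ₂0 : 0 ≤ σ₂) (hσ₂₁ : σ₂ < σ₁) (hσ₁ : σ₁ < 1) (hlam0 : 0 ≤ lam0)
    (hd0 : l (Traj f xs ud' 0) (ud' 0) ≤ C₁ * C₂ * σ₁ ^ (N - Nt) * σ₂ * lam0)
    (hd1 : l (Traj f xs ud' 1) (ud' 1) ≤
      C₁ * C₂ * σ₁ ^ (N - Nt) * σ₂ ^ 2 * lam0) :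
    A - D ≤ C₁ * C₂ * σ₁ ^ (N - Nt) * σ₂ *
      ((M / m₁ - 1) + σ₂ * (M / m₂ - 1)) * lam0 := by
  obtain ⟨hU, hx⟩ := hadmd
  let w : ℕ → (Fin m → ℝ) := fun k => if k = 0 then u₀ else if k = 1 then u₁ else ud' k
  have hw : ∀ k, 2 ≤ k → w k = ud' k := fun k hk => by
    simp only [w]
    rw [if_neg (by omega), if_neg (by omega)]
  have hw1 : Traj f xs w 1 = xs := hu₀
  have hw2 : Traj f xs w 2 = Traj f xs ud' 2 := by
    change f (Traj f xs w 1) u₁ = _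
    rw [hw1, hu₁]
  have htail : ∀ k, 2 ≤ k → Traj f xs w k = Traj f xs ud' k :=
    fun k hk => Traj_eq_of_le hw2 hw hk
  have hadm : HCAdm f U X₁ X₂ Nt Nt xs w := by
    refine ⟨fun k hk => ?_, fun k hk => ?_, fun k hk hk' => ?_⟩
    · simp only [w]
      split_ifs
      exacts [hu₀U, hu₁U, hU k hk]
    · obtain rfl : k = 0 := by omega
      rwa [hw1]
    · rw [htail (k + 1) (by omega)]
      exact hx k (by omega)
  have hA' := hA.2 w hadm
  have hcost : Cost f l xs w Nt - Cost f l xs ud' Nt =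
      (l xs u₀ - l xs (ud' 0)) + (l xs u₁ - l (Traj f xs ud' 1) (ud' 1)) := by
    obtain ⟨p, rfl⟩ := Nat.exists_eq_add_of_le' hNt₁
    have hsum : ∑ k ∈ Finset.range p, l (Traj f xs w (k + 1 + 1)) (w (k + 1 + 1)) =
        ∑ k ∈ Finset.range p, l (Traj f xs ud' (k + 1 + 1)) (ud' (k + 1 + 1)) :=
      Finset.sum_congr rfl fun k _ => by rw [htail _ (by omega), hw _ (by omega)]
    have h0 : l (Traj f xs w 0) (w 0) = l xs u₀ := rfl
    have h1 : l (Traj f xs w (0 + 1)) (w (0 + 1)) = l xs u₁ := congrArg (l · u₁) hw1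
    have h0' : l (Traj f xs ud' 0) (ud' 0) = l xs (ud' 0) := rfl
    simp only [Cost, Finset.sum_range_succ', hsum, h0, h1, h0']
    ring
  have hU0 : ud' 0 ∈ U := hU 0 (by omega)
  have hm₁M : m₁ ≤ M := (hm₁lb u₀ hu₀U).trans (hMub u₀ hu₀U)
  have hρ₁ : 0 ≤ M / m₁ - 1 := sub_nonneg.2 ((one_le_div hm₁pos).2 hm₁M)
  have hgap0 := sub_le_div_sub_one_mul hm₁pos (hm₁lb (ud' 0) hU0) hd0 hρ₁
  have hgap1 := sub_le_div_sub_one_mul hm₂pos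
    (hm₂lb (ud' 0) hU0 (ud' 1) (hU 1 (by omega))) hd1 hρ₂
  change M - l (Traj f xs ud' 1) (ud' 1) ≤ _ at hgap1
  linear_combination hA' + hcost + hcostd + hgap0 + hgap1 + hMub u₀ hu₀U + hMub u₁ hu₁U
end

section
/- Existence of a valid lower-bound constant ω (Lemma 7): Fix integers N ≥ 2 and 2 ≤ Ñ ≤ N, and let z ∈ X₁ be a point at which the minima V_Ñ^Ñ(z), V_{Ñ−1}^{Ñ−1}(z) and V_{Ñ−1}(z) are attained. Then: (i) V_Ñ^Ñ(z) ≥ V_{Ñ−1}^{Ñ−1}(z) ≥ V_{Ñ−1}(z), so for every real λ₀ ≥ 0 there exists ω ∈ [0,1) (e.g. ω = 0) with λ₀ − ( V_Ñ^Ñ(z) − V_{Ñ−1}(z) ) ≤ (1−ω)·λ₀, and hence for every α ∈ [0,1], (α/(1−ω))·( λ₀ − ( V_Ñ^Ñ(z) − V_{Ñ−1}(z) ) ) ≤ α·λ₀. (ii) If in addition l(x,u) > 0 for every (x,u) ≠ (0,0), λ₀ > 0, and some optimal trajectory (x'(n), u'(n)), n = 0,…,Ñ−1, attaining V_Ñ^Ñ(z)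 satisfies x'(Ñ−1) ≠ 0, then V_Ñ^Ñ(z) − V_{Ñ−1}(z) > 0 and there exists ω ∈ (0,1) with V_Ñ^Ñ(z) − V_{Ñ−1}(z) ≥ ω·λ₀. -/
/-- Truncating the horizon by one stage preserves HC-admissibility when the
prediction and constraint horizons coincide. -/
theorem HCAdm.truncate {n m : ℕ} {f : (Fin n → ℝ) → (Fin m → ℝ) → (Fin n → ℝ)}
    {U : Set (Fin m → ℝ)} {X₁ X₂ : Set (Fin n → ℝ)} {N : ℕ} {x : Fin n → ℝ}
    {u : ℕ → (Fin m → ℝ)} (h : HCAdm f U X₁ X₂ N N x u) :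
    HCAdm f U X₁ X₂ (N - 1) (N - 1) x u :=
  ⟨fun k hk => h.1 k (by omega), fun k hk => h.2.1 k (by omega),
    fun k hk hk' => h.2.2 k (by omega) (by omega)⟩

/-- HC-admissibility with equal horizons implies UC-admissibility. -/
theorem HCAdm.ucAdm {n m : ℕ} {f : (Fin n → ℝ) → (Fin m → ℝ) → (Fin n → ℝ)}
    {U : Set (Fin m → ℝ)} {X₁ X₂ : Set (Fin n → ℝ)} (hX : X₁ ⊆ X₂) {N : ℕ}
    {x : Fin n → ℝ} {u : ℕ → (Fin m → ℝ)} (h : HCAdm f U X₁ X₂ N N x u) :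
    UCAdm f U X₂ N x u := by
  refine ⟨h.1, fun k hk => ?_⟩
  rcases Nat.eq_zero_or_pos k with rfl | hk0
  · exact hX (h.2.1 0 (Nat.zero_le _))
  · exact h.2.2 k (by omega) (by omega)

/-- The cost over `N ≥ 1` stages splits off its last stage. -/
theorem cost_eq_cost_pred_add {n m : ℕ} (f : (Fin n → ℝ) → (Fin m → ℝ) → (Fin n → ℝ))
    (l : (Fin n → ℝ) → (Fin m → ℝ) → ℝ) (x : Fin n → ℝ) (u : ℕ → (Fin m → ℝ))
    {N : ℕ} (hN : 1 ≤ N) :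
    Cost f l x u N = Cost f l x u (N - 1) + l (Traj f x u (N - 1)) (u (N - 1)) := by
  obtain ⟨k, rfl⟩ := Nat.exists_eq_add_of_le' hN
  exact Finset.sum_range_succ _ k

/-- **Existence of a valid lower-bound constant `ω` (Lemma 7).**
(i) `V_Ñ^Ñ(z) ≥ V_{Ñ−1}^{Ñ−1}(z) ≥ V_{Ñ−1}(z)`, so for every `λ₀ ≥ 0` some
`ω ∈ [0,1)` (e.g. `ω = 0`) satisfies
`λ₀ − (V_Ñ^Ñ(z) − V_{Ñ−1}(z)) ≤ (1−ω)·λ₀`, and then for every `α ∈ [0,1]`,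
`(α/(1−ω))·(λ₀ − (V_Ñ^Ñ(z) − V_{Ñ−1}(z))) ≤ α·λ₀`.
(ii) Under joint positive definiteness of `l`, `λ₀ > 0` and existence of an
optimal trajectory for `V_Ñ^Ñ(z)` with `x'(Ñ−1) ≠ 0`, the gap
`V_Ñ^Ñ(z) − V_{Ñ−1}(z)` is strictly positive and a strictly positive
`ω ∈ (0,1)` with `V_Ñ^Ñ(z) − V_{Ñ−1}(z) ≥ ω·λ₀` exists. -/
theorem existence_of_omega_lemma7 {n m : ℕ}
    (f : (Fin n → ℝ) → (Fin m → ℝ) → (Fin n → ℝ))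
    (U : Set (Fin m → ℝ)) (X₁ X₂ : Set (Fin n → ℝ))
    (l : (Fin n → ℝ) → (Fin m → ℝ) → ℝ)
    (hl : ∀ x u, 0 ≤ l x u) (hX : X₁ ⊆ X₂)
    (N Nt : ℕ) (hN : 2 ≤ N) (hNt₁ : 2 ≤ Nt) (hNt₂ : Nt ≤ N)
    (z : Fin n → ℝ) (hz : z ∈ X₁)
    (A Ap B : ℝ)
    (hA : IsHCValue f U X₁ X₂ l Nt Nt z A)
    (hAp : IsHCValue f U X₁ X₂ l (Nt - 1) (Nt - 1) z Ap)
    (hB : IsUCValue f U X₂ l (Nt - 1) z B) :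
    (Ap ≤ A ∧ B ≤ Ap) ∧
    (∀ lam0 : ℝ, 0 ≤ lam0 →
      ∃ ω ∈ Set.Ico (0 : ℝ) 1,
        lam0 - (A - B) ≤ (1 - ω) * lam0 ∧
        ∀ α ∈ Set.Icc (0 : ℝ) 1,
          α / (1 - ω) * (lam0 - (A - B)) ≤ α * lam0) ∧
    ((∀ x' u', (x', u') ≠ ((0 : Fin n → ℝ), (0 : Fin m → ℝ)) → 0 < l x' u') →
      ∀ lam0 : ℝ, 0 < lam0 →
      (∃ u', HCAdm f U X₁ X₂ Nt Nt z u' ∧ Cost f l z u' Nt = A ∧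
        Traj f z u' (Nt - 1) ≠ 0) →
      0 < A - B ∧ ∃ ω ∈ Set.Ioo (0 : ℝ) 1, ω * lam0 ≤ A - B) := by
  have hBAp : B ≤ Ap := by
    obtain ⟨u, hu, rfl⟩ := hAp.1
    exact hB.2 u (hu.ucAdm hX)
  have last_stage : ∀ u, HCAdm f U X₁ X₂ Nt Nt z u → Cost f l z u Nt = A →
      Ap + l (Traj f z u (Nt - 1)) (u (Nt - 1)) ≤ A := by
    intro u hu hcost
    rw [← hcost, cost_eq_cost_pred_add f l z u (by omega : 1 ≤ Nt)]
    exact add_le_add_left (hAp.2 u hu.truncate) _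
  have hApA : Ap ≤ A := by
    obtain ⟨u, hu, hcost⟩ := hA.1
    linarith [last_stage u hu hcost, hl (Traj f z u (Nt - 1)) (u (Nt - 1))]
  refine ⟨⟨hApA, hBAp⟩, fun lam0 _ => ⟨0, by simp, by linarith, fun α hα => ?_⟩, ?_⟩
  · rw [sub_zero, div_one]
    exact mul_le_mul_of_nonneg_left (by linarith) hα.1
  · rintro hpos lam0 hlam ⟨u, hu, hcost, hne⟩
    have hgap : 0 < A - B := by
      have := hpos (Traj f z u (Nt - 1)) (u (Nt - 1)) fun h => hne (congrArg Prod.fst h)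
      linarith [last_stage u hu hcost]
    refine ⟨hgap, (A - B) / (A - B + lam0), ⟨by positivity, ?_⟩, ?_⟩
    · rw [div_lt_one (by positivity)]
      linarith
    · rw [div_mul_eq_mul_div, div_le_iff₀ (by positivity)]
      exact mul_le_mul_of_nonneg_left (by linarith) hgap.le
end

section
/- Explicit lower-bound constant ω (Theorem 2): Fix integers N ≥ 3 and 2 ≤ Ñ ≤ N−1. Let x_p ∈ X₁ with x_p ≠ 0, and suppose V_Ñ^Ñ(x_p) is attained by optimal pairs (x_h'(n), u_h'(n)), n = 0,…,Ñ−1, and V_Ñ(x_p) is attained by optimal pairs (x_d'(n), u_d'(n)), n = 0,…,Ñ−1, and V_{Ñ−1}(x_p) is attained. Assume there are constants C₃ ≥ 1, C₄ > 0, 0 ≤ σ₄ < σ₃ < 1, ν ≥ 0, κ ≥ 0 and reals λ₀ ≥ 0, λ₀⁺ ≥ 0, λ_p ≥ 0 such that: (i) λ_p ≥ C₃·σ₃^{N−Ñ}·λ₀⁺; (ii) l(x_d'(n), u_d'(n)) ≥ C₄·σ₄^{n+1}·λ_p for n = 0,…,Ñ−1; (iii) l(x_h'(n), u_h'(n)) −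 l(x_d'(n), u_d'(n)) ≥ ν·l(x_d'(n), u_d'(n)) for n = 0,…,Ñ−1; (iv) the first Ñ−1 stages of the optimal sequence for V_Ñ(x_p) attain V_{Ñ−1}(x_p), i.e. Σ_{n=0}^{Ñ−2} l(x_d'(n), u_d'(n)) = V_{Ñ−1}(x_p); (v) λ₀⁺ ≥ κ·λ₀. Then, with ω := C₃·C₄·κ·σ₃^{N−Ñ}·σ₄·( ν·(1−σ₄^Ñ)/(1−σ₄) + σ₄^{Ñ−1} ), one has V_Ñ^Ñ(x_p) − V_{Ñ−1}(x_p) ≥ ω·λ₀. -/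
/-- If `b` dominates the geometric sequence `c σ ^ (k + 1) p` and `a` exceeds `b` by at least
`ν b` on the first `M` terms, then the sum of `a` over `M` terms exceeds the sum of `b` over
`M - 1` terms by an explicit multiple of `p`. -/
theorem geometric_le_sum_sub_sum (a b : ℕ → ℝ) {M : ℕ} (hM : 1 ≤ M) {c σ ν p : ℝ}
    (hσ : σ ≠ 1) (hν : 0 ≤ ν) (hb : ∀ k, k < M → c * σ ^ (k + 1) * p ≤ b k)
    (hab : ∀ k, k < M → ν * b k ≤ a k - b k) :
    c * σ * (ν * (1 - σ ^ M) / (1 - σ) + σ ^ (M - 1)) * p ≤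
      ∑ k ∈ Finset.range M, a k - ∑ k ∈ Finset.range (M - 1), b k := by
  obtain ⟨M, rfl⟩ : ∃ K, M = K + 1 := ⟨M - 1, by omega⟩
  have hsum : ∑ k ∈ Finset.range (M + 1), ν * (c * σ ^ (k + 1) * p) ≤
      ∑ k ∈ Finset.range (M + 1), (a k - b k) :=
    Finset.sum_le_sum fun k hk =>
      (mul_le_mul_of_nonneg_left (hb k (Finset.mem_range.1 hk)) hν).trans
        (hab k (Finset.mem_range.1 hk))
  have hgeom : ∑ k ∈ Finset.range (M + 1), ν * (c * σ ^ (k + 1) * p) =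
      c * σ * (ν * (1 - σ ^ (M + 1)) / (1 - σ)) * p := by
    rw [mul_div_assoc, ← neg_div_neg_eq (1 - σ ^ (M + 1)), neg_sub, neg_sub,
      ← geom_sum_eq hσ, Finset.mul_sum, Finset.mul_sum, Finset.sum_mul]
    exact Finset.sum_congr rfl fun k _ => by ring
  have hlast := hb M M.lt_succ_self
  rw [Finset.sum_sub_distrib, Finset.sum_range_succ b, hgeom] at hsum
  rw [Nat.add_sub_cancel]
  linarith [pow_succ σ M, show c * σ * (ν * (1 - σ ^ (M + 1)) / (1 - σ) + σ ^ M) * p =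
    c * σ * (ν * (1 - σ ^ (M + 1)) / (1 - σ)) * p + c * σ ^ (M + 1) * p by ring]

/-- **Explicit lower-bound constant `ω` (Theorem 2).**
Under the minimum-rate cost-controllability assumption with constants
`C₃ ≥ 1`, `C₄ > 0`, `0 ≤ σ₄ < σ₃ < 1`, gap constant `ν ≥ 0` and `κ ≥ 0`,
one has `V_Ñ^Ñ(x_p) − V_{Ñ−1}(x_p) ≥ ω·λ₀` with
`ω = C₃C₄κσ₃^{N−Ñ}σ₄(ν(1−σ₄^Ñ)/(1−σ₄) + σ₄^{Ñ−1})`. -/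
theorem explicit_omega_theorem2 {n m : ℕ}
    (f : (Fin n → ℝ) → (Fin m → ℝ) → (Fin n → ℝ))
    (U : Set (Fin m → ℝ)) (X₁ X₂ : Set (Fin n → ℝ))
    (l : (Fin n → ℝ) → (Fin m → ℝ) → ℝ)
    (hl : ∀ x u, 0 ≤ l x u) (hX : X₁ ⊆ X₂)
    (N Nt : ℕ) (hN : 3 ≤ N) (hNt₁ : 2 ≤ Nt) (hNt₂ : Nt ≤ N - 1)
    (xp : Fin n → ℝ) (hxp : xp ∈ X₁) (hxp0 : xp ≠ 0)
    -- `V_Ñ^Ñ(x_p)` attained by the optimal pairs `(x_h'(k), u_h'(k))`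
    (A : ℝ) (hA : IsHCValue f U X₁ X₂ l Nt Nt xp A)
    (uh' : ℕ → (Fin m → ℝ))
    (hadmh : HCAdm f U X₁ X₂ Nt Nt xp uh')
    (hcosth : Cost f l xp uh' Nt = A)
    -- `V_Ñ(x_p)` attained by the optimal pairs `(x_d'(k), u_d'(k))`
    (D : ℝ) (hD : IsUCValue f U X₂ l Nt xp D)
    (ud' : ℕ → (Fin m → ℝ))
    (hadmd : UCAdm f U X₂ Nt xp ud')
    (hcostd : Cost f l xp ud' Nt = D)
    -- `V_{Ñ−1}(x_p)` attained
    (B : ℝ) (hB : IsUCValue f U X₂ l (Nt - 1) xp B)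
    -- constants and assumptions (i)–(v)
    (C₃ C₄ σ₃ σ₄ ν κ lam0 lam0p lamp : ℝ)
    (hC₃ : 1 ≤ C₃) (hC₄ : 0 < C₄)
    (hσ₄0 : 0 ≤ σ₄) (hσ₄₃ : σ₄ < σ₃) (hσ₃ : σ₃ < 1)
    (hν : 0 ≤ ν) (hκ : 0 ≤ κ)
    (hlam0 : 0 ≤ lam0) (hlam0p : 0 ≤ lam0p) (hlamp : 0 ≤ lamp)
    (hi : C₃ * σ₃ ^ (N - Nt) * lam0p ≤ lamp)
    (hii : ∀ k, k < Nt →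
      C₄ * σ₄ ^ (k + 1) * lamp ≤ l (Traj f xp ud' k) (ud' k))
    (hiii : ∀ k, k < Nt →
      ν * l (Traj f xp ud' k) (ud' k) ≤
        l (Traj f xp uh' k) (uh' k) - l (Traj f xp ud' k) (ud' k))
    (hiv : ∑ k ∈ Finset.range (Nt - 1), l (Traj f xp ud' k) (ud' k) = B)
    (hv : κ * lam0 ≤ lam0p) :
    C₃ * C₄ * κ * σ₃ ^ (N - Nt) * σ₄ *
      (ν * (1 - σ₄ ^ Nt) / (1 - σ₄) + σ₄ ^ (Nt - 1)) * lam0 ≤ A - B := by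
  have hlamp' : C₃ * σ₃ ^ (N - Nt) * (κ * lam0) ≤ lamp :=
    (mul_le_mul_of_nonneg_left hv
      (mul_nonneg (zero_le_one.trans hC₃) (pow_nonneg (hσ₄0.trans hσ₄₃.le) _))).trans hi
  have hgap := geometric_le_sum_sub_sum (fun k => l (Traj f xp uh' k) (uh' k))
    (fun k => l (Traj f xp ud' k) (ud' k)) (by omega : 1 ≤ Nt)
    (hσ₄₃.trans hσ₃).ne hν hii hiii
  have hbracket : 0 ≤ ν * (1 - σ₄ ^ Nt) / (1 - σ₄) + σ₄ ^ (Nt - 1) := by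
    have hσ₄1 : σ₄ ≤ 1 := (hσ₄₃.trans hσ₃).le
    have h₁ : 0 ≤ 1 - σ₄ ^ Nt := sub_nonneg.2 (pow_le_one₀ hσ₄0 hσ₄1)
    have h₂ : 0 ≤ 1 - σ₄ := sub_nonneg.2 hσ₄1
    positivity
  rw [← hcosth, ← hiv]
  refine le_trans ?_ hgap
  calc _ = C₄ * σ₄ * (ν * (1 - σ₄ ^ Nt) / (1 - σ₄) + σ₄ ^ (Nt - 1)) *
        (C₃ * σ₃ ^ (N - Nt) * (κ * lam0)) := by ring
    _ ≤ _ := mul_le_mul_of_nonneg_left hlamp'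
        (mul_nonneg (mul_nonneg hC₄.le hσ₄0) hbracket)
end

section
/- Closed-loop cost lower bound (Proposition 5): Fix integers N ≥ 2 and 2 ≤ Ñ ≤ N, and let x ∈ X₁. Let u_h* attain V_N^Ñ(x) with trajectory x_h*(·); set λ₀ = l(x, u_h*(0)) and x_s = x_h*(N−Ñ+1). Assume V_{Ñ−1}(x_s) is attained by optimal pairs (x_d'(n), u_d'(n)), n = 0,…,Ñ−2, and that the tail identity Σ_{n=N−Ñ+1}^{N−1} l(x_h*(n), u_h*(n)) = V_{Ñ−1}(x_s) holds. Assume constants C₃ ≥ 1, C₄ > 0, 0 ≤ σ₄ < σ₃ < 1 and κ ≥ 0 such that l(x_h*(n), u_h*(n)) ≥ C₃·σ₃ⁿ·κ·λ₀ for n = 0,…,N−Ñ and l(x_d'(n), u_d'(n)) ≥ C₄·σ₄^{n+1}·C₃·σ₃^{N−Ñ}·κ·λ₀ for n = 0,…,Ñ−2. Let ω ∈ [0,1) and J ∈ ℝ satisfy J ≥ V_N^Ñ(x)/(1−ω), and let m ∈ ℝ satisfy 0 ≤ m ≤ λ₀. Then J ≥ C₃·κ·[ (1−σ₃^{N−Ñ+1})/(1−σ₃)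 + C₄·σ₃^{N−Ñ}·σ₄·(1−σ₄^{Ñ−1})/(1−σ₄) ]·m/(1−ω). -/
/-- The closed form of a finite geometric sum, with ratio below `1`. -/
theorem geom_sum_eq_one_sub_div {σ : ℝ} (hσ : σ < 1) (k : ℕ) :
    (1 - σ ^ k) / (1 - σ) = ∑ i ∈ Finset.range k, σ ^ i := by
  rw [div_eq_iff (sub_pos.2 hσ).ne', geom_sum_mul_neg]

/-- **Closed-loop cost lower bound (Proposition 5).**
With the minimum-rate decay bounds and the tail identity, any `J` satisfying the
RDP lower bound `J ≥ V_N^Ñ(x)/(1−ω)` with `ω ∈ [0,1)` obeys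
`J ≥ C₃κ[(1−σ₃^{N−Ñ+1})/(1−σ₃) + C₄σ₃^{N−Ñ}σ₄(1−σ₄^{Ñ−1})/(1−σ₄)]·m/(1−ω)`. -/
theorem closed_loop_lower_bound_prop5 {n m : ℕ}
    (f : (Fin n → ℝ) → (Fin m → ℝ) → (Fin n → ℝ))
    (U : Set (Fin m → ℝ)) (X₁ X₂ : Set (Fin n → ℝ))
    (l : (Fin n → ℝ) → (Fin m → ℝ) → ℝ)
    (hl : ∀ x u, 0 ≤ l x u) (hX : X₁ ⊆ X₂)
    (N Nt : ℕ) (hN : 2 ≤ N) (hNt₁ : 2 ≤ Nt) (hNt₂ : Nt ≤ N)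
    (x : Fin n → ℝ) (hx : x ∈ X₁)
    -- the optimal sequence attaining `V_N^Ñ(x)`
    (uh : ℕ → (Fin m → ℝ)) (V : ℝ)
    (hadm : HCAdm f U X₁ X₂ N Nt x uh)
    (hcost : Cost f l x uh N = V)
    (hmin : ∀ u', HCAdm f U X₁ X₂ N Nt x u' → V ≤ Cost f l x u' N)
    (lam0 : ℝ) (hlam0 : lam0 = l x (uh 0))
    -- `V_{Ñ−1}(x_s)` attained by the optimal pairs `(x_d'(k), u_d'(k))`
    (B : ℝ)
    (hB : IsUCValue f U X₂ l (Nt - 1) (Traj f x uh (N - Nt + 1)) B)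
    (ud' : ℕ → (Fin m → ℝ))
    (hadmd : UCAdm f U X₂ (Nt - 1) (Traj f x uh (N - Nt + 1)) ud')
    (hcostd : Cost f l (Traj f x uh (N - Nt + 1)) ud' (Nt - 1) = B)
    -- tail identity
    (htail : ∑ k ∈ Finset.Ico (N - Nt + 1) N, l (Traj f x uh k) (uh k) = B)
    -- decay-rate assumptions
    (C₃ C₄ σ₃ σ₄ κ : ℝ)
    (hC₃ : 1 ≤ C₃) (hC₄ : 0 < C₄)
    (hσ₄0 : 0 ≤ σ₄) (hσ₄₃ : σ₄ < σ₃) (hσ₃ : σ₃ < 1) (hκ : 0 ≤ κ)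
    (hi : ∀ k, k ≤ N - Nt → C₃ * σ₃ ^ k * κ * lam0 ≤ l (Traj f x uh k) (uh k))
    (hii : ∀ k, k ≤ Nt - 2 →
      C₄ * σ₄ ^ (k + 1) * C₃ * σ₃ ^ (N - Nt) * κ * lam0 ≤
        l (Traj f (Traj f x uh (N - Nt + 1)) ud' k) (ud' k))
    -- the RDP lower bound and the cost lower bound `m`
    (ω J mlb : ℝ) (hω : ω ∈ Set.Ico (0 : ℝ) 1)
    (hJ : V / (1 - ω) ≤ J) (hm : 0 ≤ mlb) (hmlam : mlb ≤ lam0) :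
    C₃ * κ * ((1 - σ₃ ^ (N - Nt + 1)) / (1 - σ₃) +
      C₄ * σ₃ ^ (N - Nt) * σ₄ * (1 - σ₄ ^ (Nt - 1)) / (1 - σ₄)) * mlb / (1 - ω) ≤ J := by
  have hσ₃0 : 0 ≤ σ₃ := hσ₄0.trans hσ₄₃.le
  have hC₃0 : 0 ≤ C₃ := zero_le_one.trans hC₃
  have hω1 : 0 < 1 - ω := sub_pos.2 hω.2
  have hhead : C₃ * κ * (∑ k ∈ Finset.range (N - Nt + 1), σ₃ ^ k) * lam0 ≤
      ∑ k ∈ Finset.range (N - Nt + 1), l (Traj f x uh k) (uh k) := by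
    rw [Finset.mul_sum, Finset.sum_mul]
    refine Finset.sum_le_sum fun k hk => ?_
    have hk' := Finset.mem_range.1 hk
    linarith [hi k (by omega)]
  have htail_le : C₃ * κ * (C₄ * σ₃ ^ (N - Nt) * σ₄ *
      ∑ k ∈ Finset.range (Nt - 1), σ₄ ^ k) * lam0 ≤ B := by
    rw [← hcostd, Cost, Finset.mul_sum, Finset.mul_sum, Finset.sum_mul]
    refine Finset.sum_le_sum fun k hk => ?_
    have hk' := Finset.mem_range.1 hk
    refine le_trans (le_of_eq ?_) (hii k (by omega))
    ring
  have hsplit : V = ∑ k ∈ Finset.range (N - Nt + 1), l (Traj f x uh k) (uh k) + B := by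
    rw [← hcost, ← htail, Cost, Finset.sum_range_add_sum_Ico _ (by omega)]
  rw [mul_div_assoc _ (1 - σ₄ ^ (Nt - 1)), geom_sum_eq_one_sub_div hσ₃,
    geom_sum_eq_one_sub_div (hσ₄₃.trans hσ₃)]
  refine le_trans (div_le_div_of_nonneg_right ?_ hω1.le) hJ
  calc
    _ ≤ C₃ * κ * (∑ k ∈ Finset.range (N - Nt + 1), σ₃ ^ k +
        C₄ * σ₃ ^ (N - Nt) * σ₄ * ∑ k ∈ Finset.range (Nt - 1), σ₄ ^ k) * lam0 :=
      mul_le_mul_of_nonneg_left hmlam (by positivity)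
    _ ≤ V := by linarith
end

section
/- Compatibility of the lower- and upper-bound constants (Proposition 6): Let C₁ ≥ 1, C₂ > 0, C₃ ≥ 1, C₄ > 0, κ ≥ 0, and real decay rates satisfying 0 ≤ σ₄ < σ₃ ≤ σ₁ < 1 and σ₄ ≤ σ₂ < σ₁, and let δ ≥ ν ≥ 0. Let N, Ñ be integers with N ≥ 3 and 2 ≤ Ñ ≤ N−1, and define ω := C₃·C₄·κ·σ₃^{N−Ñ}·σ₄·( ν·(1−σ₄^Ñ)/(1−σ₄) + σ₄^{Ñ−1} ) and 1−α := C₁·C₂·σ₁^{N−Ñ}·σ₂·( δ·(1−σ₂^Ñ)/(1−σ₂) + σ₂^{Ñ−1} ). If either (a) σ₄ > 0, κ > 0 and (N−Ñ)·log(σ₁/σ₃) ≥ log( C₃·C₄·κ/(C₁·C₂) ), or (b) σ₄ = 0, or (c) κ = 0, then 0 ≤ ω ≤ 1−α. -/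
theorem mul_one_sub_pow_div_one_sub_eq_geom_sum {K : Type*} [Field K] (c : K) {s : K}
    (hs : s ≠ 1) (n : ℕ) :
    c * (1 - s ^ n) / (1 - s) = c * ∑ i ∈ Finset.range n, s ^ i := by
  have h : 1 - s ≠ 0 := sub_ne_zero.mpr hs.symm
  rw [div_eq_iff h, mul_assoc, geom_sum_mul_neg]

theorem mul_pow_le_mul_pow_of_log_div_le {a b x y : ℝ} (ha : 0 < a) (hb : 0 < b) (hx : 0 < x)
    (hy : 0 < y) {n : ℕ} (h : Real.log (a / b) ≤ n * Real.log (y / x)) :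
    a * x ^ n ≤ b * y ^ n := by
  rw [← Real.log_pow, Real.log_le_log_iff (by positivity) (by positivity), div_pow,
    div_le_div_iff₀ hb (by positivity)] at h
  linarith


/-- **Compatibility of the lower- and upper-bound constants (Proposition 6).**
With `ω = C₃C₄κσ₃^{N−Ñ}σ₄(ν(1−σ₄^Ñ)/(1−σ₄) + σ₄^{Ñ−1})` and
`1−α = C₁C₂σ₁^{N−Ñ}σ₂(δ(1−σ₂^Ñ)/(1−σ₂) + σ₂^{Ñ−1})`, if either
(a) `σ₄ > 0`, `κ > 0` and `(N−Ñ)·log(σ₁/σ₃) ≥ log(C₃C₄κ/(C₁C₂))`, or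
(b) `σ₄ = 0`, or (c) `κ = 0`, then `0 ≤ ω ≤ 1−α`. -/
theorem omega_alpha_compatibility
    (C₁ C₂ C₃ C₄ κ σ₁ σ₂ σ₃ σ₄ δ ν : ℝ)
    (hC₁ : 1 ≤ C₁) (hC₂ : 0 < C₂) (hC₃ : 1 ≤ C₃) (hC₄ : 0 < C₄) (hκ : 0 ≤ κ)
    (hσ₄0 : 0 ≤ σ₄) (hσ₄₃ : σ₄ < σ₃) (hσ₃₁ : σ₃ ≤ σ₁) (hσ₁ : σ₁ < 1)
    (hσ₄₂ : σ₄ ≤ σ₂) (hσ₂₁ : σ₂ < σ₁)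
    (hν : 0 ≤ ν) (hδν : ν ≤ δ)
    (N Nt : ℕ) (hN : 3 ≤ N) (hNt₁ : 2 ≤ Nt) (hNt₂ : Nt ≤ N - 1)
    (hcase :
      (0 < σ₄ ∧ 0 < κ ∧
        Real.log (C₃ * C₄ * κ / (C₁ * C₂)) ≤
          ((N : ℝ) - (Nt : ℝ)) * Real.log (σ₁ / σ₃)) ∨
      σ₄ = 0 ∨ κ = 0) :
    0 ≤ C₃ * C₄ * κ * σ₃ ^ (N - Nt) * σ₄ *
        (ν * (1 - σ₄ ^ Nt) / (1 - σ₄) + σ₄ ^ (Nt - 1)) ∧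
    C₃ * C₄ * κ * σ₃ ^ (N - Nt) * σ₄ *
        (ν * (1 - σ₄ ^ Nt) / (1 - σ₄) + σ₄ ^ (Nt - 1)) ≤
      C₁ * C₂ * σ₁ ^ (N - Nt) * σ₂ *
        (δ * (1 - σ₂ ^ Nt) / (1 - σ₂) + σ₂ ^ (Nt - 1)) := by
  have hσ₂0 : 0 ≤ σ₂ := hσ₄0.trans hσ₄₂
  have hσ₃0 : 0 < σ₃ := hσ₄0.trans_lt hσ₄₃
  have hσ₁0 : 0 < σ₁ := hσ₃0.trans_le hσ₃₁
  have hδ : 0 ≤ δ := hν.trans hδν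
  have hC₁0 : 0 < C₁ := one_pos.trans_le hC₁
  have hC₃0 : 0 < C₃ := one_pos.trans_le hC₃
  rw [mul_one_sub_pow_div_one_sub_eq_geom_sum ν (by linarith : σ₄ < 1).ne,
    mul_one_sub_pow_div_one_sub_eq_geom_sum δ (hσ₂₁.trans hσ₁).ne]
  refine ⟨by positivity, ?_⟩
  rcases hcase with ⟨-, hκ0, hlog⟩ | rfl | rfl
  · have hcoef : C₃ * C₄ * κ * σ₃ ^ (N - Nt) ≤ C₁ * C₂ * σ₁ ^ (N - Nt) := by
      refine mul_pow_le_mul_pow_of_log_div_le (by positivity) (by positivity) hσ₃0 hσ₁0 ?_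
      rwa [Nat.cast_sub (by omega)]
    gcongr
  · simp only [mul_zero, zero_mul]
    positivity
  · simp only [mul_zero, zero_mul]
    positivity
end
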